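/- Let Γ₂ = ℤ + ℤi ⊂ ℂ, let T = (ℂ/Γ₂)³, let F : T → T be induced by z ↦ (iz₁, iz₂ − iz₁, −z₃), let M be the mapping torus of F, let κ : M → M be κ[t,x] = [1−t, η(x)] with η : T → T induced by z ↦ (−z̄₁, z̄₂ + z̄₁, −z̄₃), and let X = M/κ be the quotient topological space. Then X is path-connected and its fundamental group is isomorphic to ℤ/2ℤ. -/

import Mathlib

/-- The Gaussian lattice `Γ₂ = ℤ + ℤi ⊂ ℂ`. -/
noncomputable def Γ₂ : AddSubgroup ℂ := AddSubgroup.closure {1, Complex.I}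

/-- The torus `T = (ℂ/Γ₂)³`. -/
abbrev T₂ : Type := (ℂ ⧸ Γ₂) × (ℂ ⧸ Γ₂) × (ℂ ⧸ Γ₂)

/-- The projection `ℂ → ℂ/Γ₂`. -/
noncomputable def mk₂ : ℂ → ℂ ⧸ Γ₂ := QuotientAddGroup.mk

/-- The mapping-torus relation on `ℝ × T` generated by `(t, x) ∼ (t + 1, F x)`. -/
def mtRel (F : T₂ → T₂) (x y : ℝ × T₂) : Prop := y = (x.1 + 1, F x.2)
open Topology unitInterval in
/-- An orbifold-type presentation `π : E → X` of `X` as a quotient of a real normed space by a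
group acting by affine homeomorphisms. -/
structure OrbPres {E X G : Type*} [NormedAddCommGroup E] [NormedSpace ℝ E] [TopologicalSpace X]
    [Group G] [MulAction G E] (π : E → X) : Prop where
  cont : ∀ g : G, Continuous (fun e : E => g • e)
  aff : ∀ (g : G) (a b : E) (s : ℝ),
    g • (AffineMap.lineMap a b s : E) = AffineMap.lineMap (g • a) (g • b) s
  quot : IsQuotientMap π
  orb : ∀ a b : E, π a = π b ↔ ∃ g : G, g • a = b
  loc : ∀ p : E, ∃ U : Set E, IsOpen U ∧ Convex ℝ U ∧ p ∈ U ∧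
    ∀ g : G, ∀ u ∈ U, g • u ∈ U → g • p = p

namespace OrbPres

open Topology unitInterval

variable {E X G : Type*} [NormedAddCommGroup E] [NormedSpace ℝ E] [TopologicalSpace X]
    [Group G] [MulAction G E] {π : E → X}

theorem isOpenMap (h : OrbPres (G := G) π) : IsOpenMap π := by
  intro U hU
  rw [← h.quot.isOpen_preimage]
  have : π ⁻¹' (π '' U) = ⋃ g : G, (fun e : E => g • e) ⁻¹' U := by
    ext e
    simp only [Set.mem_preimage, Set.mem_image, Set.mem_iUnion]
    constructor
    · rintro ⟨u, hu, hue⟩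
      obtain ⟨g, hg⟩ := (h.orb e u).1 hue.symm
      exact ⟨g, by rw [hg]; exact hu⟩
    · rintro ⟨g, hg⟩
      exact ⟨_, hg, ((h.orb _ _).2 ⟨g, rfl⟩).symm⟩
  rw [this]
  exact isOpen_iUnion fun g => hU.preimage (h.cont g)

theorem simply (h : OrbPres (G := G) π) {p : E} {U : Set E} (hU : IsOpen U) (hc : Convex ℝ U)
    (hp : p ∈ U) (hg : ∀ g : G, ∀ u ∈ U, g • u ∈ U → g • p = p) :
    SimplyConnectedSpace (π '' U) := by
  suffices ContractibleSpace (π '' U) from inferInstance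
  rw [contractible_iff_id_nullhomotopic]
  let q : U → π '' U := fun u => ⟨π u, u, u.2, rfl⟩
  have hqc : Continuous q := (h.quot.continuous.comp continuous_subtype_val).subtype_mk _
  have hqs : Function.Surjective q := by
    rintro ⟨_, u, hu, rfl⟩; exact ⟨⟨u, hu⟩, rfl⟩
  have hqo : IsOpenMap q := by
    have h1 : IsOpenMap (fun u : U => π u) := h.isOpenMap.comp hU.isOpenMap_subtype_val
    intro W hW
    have h2 := h1 W hW
    have : q '' W = Subtype.val ⁻¹' ((fun u : U => π u) '' W) := by
      ext ⟨y, hy⟩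
      simp [q, Subtype.ext_iff]
    rw [this]
    exact h2.preimage continuous_subtype_val
  have hQ : IsQuotientMap (Prod.map (id : I → I) q) :=
    ((IsOpenQuotientMap.id).prodMap ⟨hqs, hqc, hqo⟩).isQuotientMap
  let K : I × U → π '' U := fun x => q ⟨AffineMap.lineMap (x.2 : E) p (x.1 : ℝ), by
    exact hc.lineMap_mem x.2.2 hp x.1.2⟩
  have hK : Continuous K := by
    refine hqc.comp (Continuous.subtype_mk ?_ _)
    simp only [AffineMap.lineMap_apply]
    fun_prop
  have hKK : ∀ a b : I × U, Prod.map (id : I → I) q a = Prod.map id q b → K a = K b := by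
    rintro ⟨s, u⟩ ⟨s', u'⟩ hab
    simp only [Prod.map, id, Prod.mk.injEq, q] at hab
    obtain ⟨rfl, huu⟩ := hab
    obtain ⟨g, hgu⟩ := (h.orb _ _).1 (congrArg Subtype.val huu)
    have hgp : g • p = p := hg g u u.2 (by rw [hgu]; exact u'.2)
    refine Subtype.ext ?_
    refine (h.orb _ _).2 ⟨g, ?_⟩
    rw [h.aff]; simp [hgu, hgp]
  let c : C(I × U, π '' U) := ⟨K, hK⟩
  let H0 : C(I × (π '' U), π '' U) := IsQuotientMap.lift (f := ⟨_, hQ.continuous⟩) hQ c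
    (fun a b hab => hKK a b hab)
  have hH0 : ∀ s u, H0 (s, q u) = K (s, u) := by
    intro s u
    have := IsQuotientMap.lift_comp (f := ⟨_, hQ.continuous⟩) hQ c (fun a b hab => hKK a b hab)
    exact DFunLike.congr_fun this (s, u)
  refine ⟨q ⟨p, hp⟩, ⟨⟨H0, ?_, ?_⟩⟩⟩
  · intro y
    obtain ⟨u, rfl⟩ := hqs y
    change H0 (0, q u) = q u
    rw [hH0]; simp [K]
  · intro y
    obtain ⟨u, rfl⟩ := hqs y
    change H0 (1, q u) = q ⟨p, hp⟩
    rw [hH0]; simp [K]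

/-- The image in `X` of the segment from `a` to `b`. -/
noncomputable def seg (h : OrbPres (G := G) π) (a b : E) : Path (π a) (π b) :=
  (Path.segment a b).map h.quot.continuous

theorem seg_self (h : OrbPres (G := G) π) (a : E) : h.seg a a = Path.refl (π a) := by
  ext s
  simp [seg]

theorem map_smul (h : OrbPres (G := G) π) (g : G) (a : E) : π (g • a) = π a :=
  ((h.orb _ _).2 ⟨g, rfl⟩).symm

theorem seg_smul (h : OrbPres (G := G) π) (g : G) (a b : E) :
    h.seg (g • a) (g • b) = (h.seg a b).cast (h.map_smul g a) (h.map_smul g b) := by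
  ext s
  simp only [seg, Path.map_coe, Function.comp, Path.cast_coe, Path.segment_apply]
  rw [← h.aff, h.map_smul]

theorem seg_trans (h : OrbPres (G := G) π) (a b c : E) :
    ((h.seg a b).trans (h.seg b c)).Homotopic (h.seg a c) := by
  have : ContractibleSpace E := inferInstance
  have h1 : ((Path.segment a b).trans (Path.segment b c)).Homotopic (Path.segment a c) :=
    SimplyConnectedSpace.paths_homotopic _ _
  have h2 := h1.map ⟨π, h.quot.continuous⟩
  rw [Path.map_trans] at h2
  exact h2

/-- Path lifting up to homotopy. -/
def LP (h : OrbPres (G := G) π) {x y : X} (γ : Path x y) : Prop :=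
  ∀ (a : E) (ha : x = π a), ∃ (b : E) (hb : y = π b), γ.Homotopic ((h.seg a b).cast ha hb)

theorem LP.refl (h : OrbPres (G := G) π) (x : X) : h.LP (Path.refl x) := by
  rintro a rfl
  exact ⟨a, rfl, by rw [seg_self]; exact Path.Homotopic.refl _⟩

theorem LP.trans {h : OrbPres (G := G) π} {x y z : X} {γ : Path x y} {δ : Path y z}
    (h1 : h.LP γ) (h2 : h.LP δ) : h.LP (γ.trans δ) := by
  rintro a rfl
  obtain ⟨b, rfl, hb⟩ := h1 a rfl
  obtain ⟨c, rfl, hc⟩ := h2 b rfl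
  exact ⟨c, rfl, (hb.hcomp hc).trans (h.seg_trans a b c)⟩

theorem LP.homot {h : OrbPres (G := G) π} {x y : X} {γ δ : Path x y}
    (h1 : h.LP γ) (h2 : γ.Homotopic δ) : h.LP δ := by
  rintro a rfl
  obtain ⟨b, rfl, hb⟩ := h1 a rfl
  exact ⟨b, rfl, h2.symm.trans hb⟩

theorem LP.cast' {h : OrbPres (G := G) π} {x y x' y' : X} {γ : Path x y} {hx : x' = x}
    {hy : y' = y} (h1 : h.LP (γ.cast hx hy)) : h.LP γ := by
  subst hx hy; exact h1

theorem LP.loc_path (h : OrbPres (G := G) π) {p : E} {U : Set E} (hU : IsOpen U) (hc : Convex ℝ U)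
    (hp : p ∈ U) (hg : ∀ g : G, ∀ u ∈ U, g • u ∈ U → g • p = p) {x y : X} (γ : Path x y)
    (hγ : ∀ s, γ s ∈ π '' U) : h.LP γ := by
  intro a ha
  have hx := hγ 0
  have hy := hγ 1
  rw [γ.source] at hx
  rw [γ.target] at hy
  obtain ⟨u, hu, rfl⟩ := hx
  obtain ⟨v, hv, rfl⟩ := hy
  obtain ⟨g, rfl⟩ := (h.orb _ _).1 ha
  refine ⟨g • v, (h.map_smul g v).symm, ?_⟩
  have key : γ.Homotopic (h.seg u v) := by
    have := h.simply hU hc hp hg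
    let X0 : π '' U := ⟨π u, u, hu, rfl⟩
    let X1 : π '' U := ⟨π v, v, hv, rfl⟩
    let γ' : Path X0 X1 := ⟨⟨fun s => ⟨γ s, hγ s⟩, by fun_prop⟩, by simp [X0], by simp [X1]⟩
    let δ' : Path X0 X1 := ⟨⟨fun s => ⟨h.seg u v s,
      ⟨_, hc.lineMap_mem hu hv s.2, rfl⟩⟩, by fun_prop⟩, by simp [X0], by simp [X1]⟩
    have h1 : γ'.Homotopic δ' := SimplyConnectedSpace.paths_homotopic _ _
    exact h1.map ⟨Subtype.val, continuous_subtype_val⟩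
  have : (h.seg (g • u) (g • v)).cast ha (h.map_smul g v).symm = h.seg u v := by
    rw [seg_smul]; rfl
  rw [this]
  exact key

theorem lp (h : OrbPres (G := G) π) {x y : X} (γ : Path x y) : h.LP γ := by
  choose U hU hc hp hg using h.loc
  obtain ⟨t, t0, tm, ⟨n, hn⟩, ht⟩ := exists_monotone_Icc_subset_open_cover_unitInterval
    (c := fun p : E => γ ⁻¹' (π '' U p))
    (fun p => (h.isOpenMap _ (hU p)).preimage γ.continuous) (by
      intro s _
      obtain ⟨e, he⟩ := h.quot.surjective (γ s)
      exact Set.mem_iUnion.2 ⟨e, e, hp e, he⟩)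
  have key : ∀ m, h.LP (γ.subpath 0 (t m)) := by
    intro m
    induction m with
    | zero => rw [t0, Path.subpath_self]; exact LP.refl h _
    | succ m ih =>
      obtain ⟨p, hpm⟩ := ht m
      refine (ih.trans (LP.loc_path h (hU p) (hc p) (hp p) (hg p)
        (γ.subpath (t m) (t (m + 1))) ?_)).homot ⟨Path.Homotopy.subpathTransSubpath γ _ _ _⟩
      intro s
      have h1 : γ.subpath (t m) (t (m + 1)) s ∈ Set.range (γ.subpath (t m) (t (m + 1))) := ⟨s, rfl⟩
      rw [Path.range_subpath_of_le _ _ _ (tm (Nat.le_succ m))] at h1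
      obtain ⟨r, hr, hrs⟩ := h1
      rw [← hrs]
      exact hpm hr
  have := key n
  rw [hn n le_rfl, Path.subpath_zero_one] at this
  exact this.cast'

/-- The homomorphism from `G` to the fundamental group of the quotient. -/
noncomputable def psi (h : OrbPres (G := G) π) (a : E) : G →* FundamentalGroup X (π a) where
  toFun g := FundamentalGroup.fromPath
    (Path.Homotopic.Quotient.mk ((h.seg (g • a) a).cast (h.map_smul g a).symm rfl))
  map_one' := by
    rw [FundamentalGroup.one_def, ← Path.Homotopic.Quotient.mk_refl]
    change Path.Homotopic.Quotient.mk _ = Path.Homotopic.Quotient.mk _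
    congr 1
    ext s
    simp [seg]
  map_mul' g g' := by
    rw [FundamentalGroup.mul_def]
    change Path.Homotopic.Quotient.mk _ =
      (Path.Homotopic.Quotient.mk _).trans (Path.Homotopic.Quotient.mk _)
    rw [← Path.Homotopic.Quotient.mk_trans, Path.Homotopic.Quotient.eq]
    have h1 := (h.seg_trans ((g * g') • a) (g • a) a).symm.pathCast
      (h.map_smul (g * g') a).symm rfl
    refine h1.trans ?_
    have h2 : h.seg ((g * g') • a) (g • a) =
      (h.seg (g' • a) a).cast (by simp [mul_smul, h.map_smul]) (h.map_smul g a) := by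
      ext s
      have := congrArg (fun γ => γ s) (h.seg_smul g (g' • a) a)
      simpa [seg, mul_smul] using this
    rw [h2]
    have h3 : ∀ {x y z y' x' : X} (p : Path x y) (q : Path y' z) (e1 : x' = x) (e2 : y' = y),
      ((p.cast e1 e2).trans q) = (p.trans (q.cast e2.symm rfl)).cast e1 rfl := by
      intros; subst_vars; rfl
    rw [h3]
    rfl

theorem psi_surj (h : OrbPres (G := G) π) (a : E) : Function.Surjective (h.psi a) := by
  intro γ
  obtain ⟨γ, rfl⟩ := Path.Homotopic.Quotient.mk_surjective γ
  obtain ⟨b, hb, hγ⟩ := h.lp γ a rfl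
  obtain ⟨g, rfl⟩ := (h.orb _ _).1 hb
  refine ⟨g⁻¹, ?_⟩
  change Path.Homotopic.Quotient.mk _ = Path.Homotopic.Quotient.mk _
  rw [Path.Homotopic.Quotient.eq]
  refine Path.Homotopic.trans ?_ hγ.symm
  have : ((h.seg (g⁻¹ • a) a).cast (h.map_smul g⁻¹ a).symm rfl) =
      (h.seg a (g • a)).cast rfl hb := by
    ext s
    have := congrArg (fun γ => γ s) (h.seg_smul g⁻¹ a (g • a))
    simpa [seg] using this
  rw [this]

theorem psi_fix (h : OrbPres (G := G) π) (a : E) (g : G) (q : E) (hq : g • q = q) :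
    h.psi a g = 1 := by
  rw [FundamentalGroup.one_def, ← Path.Homotopic.Quotient.mk_refl]
  change Path.Homotopic.Quotient.mk _ = Path.Homotopic.Quotient.mk _
  rw [Path.Homotopic.Quotient.eq]
  have h1 := (h.seg_trans (g • a) q a).symm.pathCast (h.map_smul g a).symm rfl
  refine h1.trans ?_
  have h2 : ((h.seg (g • a) q).trans (h.seg q a)).cast (h.map_smul g a).symm rfl =
      (h.seg a q).trans (h.seg q a) := by
    have : h.seg (g • a) q = (h.seg a q).cast (h.map_smul g a) rfl := by
      ext s
      have := congrArg (fun γ => γ s) (h.seg_smul g a q)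
      simpa [seg, hq] using this
    rw [this]
    rfl
  rw [h2]
  have h3 := h.seg_trans a q a
  rw [seg_self] at h3
  exact h3

end OrbPres

namespace OrbPres

open Topology

variable {E X G K : Type*} [NormedAddCommGroup E] [NormedSpace ℝ E] [TopologicalSpace X]
    [Group G] [MulAction G E] {π : E → X} [CommGroup K]

/-- The orbit relation on `E × K`. -/
def covSetoid (E : Type*) [MulAction G E] (φ : G →* K) : Setoid (E × K) where
  r x y := ∃ g : G, g • x.1 = y.1 ∧ φ g * x.2 = y.2
  iseqv := by
    refine ⟨fun x => ⟨1, by simp⟩, ?_, ?_⟩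
    · rintro x y ⟨g, h1, h2⟩
      exact ⟨g⁻¹, by rw [← h1]; simp, by rw [← h2]; simp⟩
    · rintro x y z ⟨g, h1, h2⟩ ⟨g', h3, h4⟩
      exact ⟨g' * g, by rw [mul_smul, h1, h3], by rw [map_mul, mul_assoc, h2, h4]⟩

/-- The covering space. -/
abbrev Cov (E : Type*) [MulAction G E] (φ : G →* K) : Type _ := Quotient (covSetoid E φ)

instance covAction (φ : G →* K) : MulAction K (Cov E φ) where
  smul k := Quotient.map (fun x => (x.1, k * x.2)) (by
    rintro x y ⟨g, h1, h2⟩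
    exact ⟨g, h1, by simp only; rw [← h2, mul_left_comm]⟩)
  one_smul := by
    rintro ⟨x⟩
    change Quotient.mk _ (x.1, 1 * x.2) = Quotient.mk _ x
    simp
  mul_smul := by
    rintro k k' ⟨x⟩
    change Quotient.mk _ (x.1, (k * k') * x.2) = Quotient.mk _ (x.1, k * (k' * x.2))
    rw [mul_assoc]

variable [TopologicalSpace K] [DiscreteTopology K]

/-- The covering map. -/
def covMap (h : OrbPres (G := G) π) (φ : G →* K) : Cov E φ → X :=
  Quotient.lift (fun x => π x.1) (by
    rintro x y ⟨g, h1, -⟩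
    exact (h.orb _ _).2 ⟨g, h1⟩)

theorem cov_open (h : OrbPres (G := G) π) (φ : G →* K) :
    IsOpenMap (Quotient.mk (covSetoid E φ)) := by
  intro U hU
  rw [← isQuotientMap_quotient_mk'.isOpen_preimage]
  have : (Quotient.mk (covSetoid E φ)) ⁻¹' (Quotient.mk (covSetoid E φ) '' U) =
      ⋃ g : G, (fun e : E × K => (g • e.1, φ g * e.2)) ⁻¹' U := by
    ext e
    simp only [Set.mem_preimage, Set.mem_image, Set.mem_iUnion]
    constructor
    · rintro ⟨u, hu, hue⟩
      obtain ⟨g, hg, hg'⟩ := Quotient.exact hue.symm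
      refine ⟨g, ?_⟩
      rw [hg, hg']
      exact hu
    · rintro ⟨g, hg⟩
      exact ⟨_, hg, (Quotient.sound ⟨g, rfl, rfl⟩ : Quotient.mk (covSetoid E φ) e = _).symm⟩
  change IsOpen ((Quotient.mk (covSetoid E φ)) ⁻¹' (Quotient.mk (covSetoid E φ) '' U))
  rw [this]
  refine isOpen_iUnion fun g => hU.preimage ?_
  exact ((h.cont g).comp continuous_fst).prodMk
    ((continuous_of_discreteTopology (f := fun k : K => φ g * k)).comp continuous_snd)

theorem covering (h : OrbPres (G := G) π) (φ : G →* K)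
    (hfix : ∀ (g : G) (p : E), g • p = p → φ g = 1) :
    IsQuotientCoveringMap (h.covMap φ) K where
  toIsQuotientMap := by
    have h1 : IsQuotientMap (fun x : E × K => π x.1) :=
      h.quot.comp (isOpenQuotientMap_fst).isQuotientMap
    have h2 : Continuous (h.covMap φ) := h1.continuous.quotient_lift _
    exact IsQuotientMap.of_comp continuous_quotient_mk' h2 h1
  continuous_const_smul k := by
    refine isQuotientMap_quotient_mk'.continuous_iff.2 ?_
    refine continuous_quotient_mk'.comp (X := E × K) (f := fun x => (x.1, k * x.2)) ?_
    exact continuous_fst.prodMk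
      ((continuous_of_discreteTopology (f := fun l : K => k * l)).comp continuous_snd)
  apply_eq_iff_mem_orbit := by
    rintro ⟨x⟩ ⟨y⟩
    constructor
    · intro hxy
      obtain ⟨g, hg⟩ := (h.orb _ _).1 (show π x.1 = π y.1 from hxy)
      refine ⟨(φ g * x.2) * y.2⁻¹, ?_⟩
      exact (Quotient.sound ⟨g, hg, (inv_mul_cancel_right _ _).symm⟩ : Quotient.mk (covSetoid E φ) x =
        Quotient.mk (covSetoid E φ) (y.1, (φ g * x.2) * y.2⁻¹ * y.2)).symm
    · rintro ⟨k, hk⟩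
      change h.covMap φ (Quotient.mk _ x) = h.covMap φ (Quotient.mk _ y)
      change Quotient.mk _ _ = Quotient.mk _ x at hk
      rw [← hk]
      rfl
  disjoint := by
    rintro ⟨p, δ⟩
    obtain ⟨U, hU, hc, hp, hg⟩ := h.loc p
    refine ⟨Quotient.mk (covSetoid E φ) '' (U ×ˢ {δ}),
      (h.cov_open φ _ (hU.prod (isOpen_discrete _))).mem_nhds ⟨(p, δ), ⟨hp, rfl⟩, rfl⟩, ?_⟩
    rintro k ⟨_, ⟨_, ⟨⟨u, δ1⟩, ⟨hu, hδ1⟩, rfl⟩, rfl⟩, ⟨⟨v, δ2⟩, ⟨hv, hδ2⟩, he⟩⟩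
    simp only [Set.mem_singleton_iff] at hδ1 hδ2
    subst hδ1 hδ2
    obtain ⟨g, h1, h2⟩ := Quotient.exact he
    simp only at h1 h2 hu hv
    have h3 : φ g = 1 := hfix g p (hg g v hv (by rw [h1]; exact hu))
    rw [h3] at h2
    simpa using h2.symm

theorem cov_pathConn (φ : G →* K) (hφ : Function.Surjective φ) :
    PathConnectedSpace (Cov E φ) := by
  have hc : Continuous (fun e : E => (Quotient.mk (covSetoid E φ) (e, 1))) :=
    continuous_quotient_mk'.comp (by fun_prop)
  have hs : Function.Surjective (fun e : E => (Quotient.mk (covSetoid E φ) (e, 1))) := by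
    rintro ⟨p, k⟩
    obtain ⟨g, hg⟩ := hφ k⁻¹
    exact ⟨g • p, (Quotient.sound ⟨g, rfl, by simp [hg]⟩ :
      Quotient.mk (covSetoid E φ) (p, k) = _).symm⟩
  exact hs.pathConnectedSpace hc

theorem main (h : OrbPres (G := G) π) (φ : G →* Multiplicative (ZMod 2))
    (hφ : Function.Surjective φ)
    (hfix : ∀ (g : G) (p : E), g • p = p → φ g = 1)
    (hpsi : ∀ (x : X) (Ψ : G →* FundamentalGroup X x), (∀ (g : G) (p : E), g • p = p → Ψ g = 1) →
      ∃ w, ∀ g, Ψ g = 1 ∨ Ψ g = w) :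
    PathConnectedSpace X ∧ ∀ x : X, Nonempty (FundamentalGroup X x ≃* Multiplicative (ZMod 2)) := by
  have hX : PathConnectedSpace X := h.quot.surjective.pathConnectedSpace h.quot.continuous
  refine ⟨hX, fun x => ?_⟩
  obtain ⟨a, rfl⟩ := h.quot.surjective x
  let _ : TopologicalSpace (Multiplicative (ZMod 2)) := ⊥
  have : DiscreteTopology (Multiplicative (ZMod 2)) := ⟨rfl⟩
  have hcov := h.covering φ hfix
  have := cov_pathConn (E := E) φ hφ
  have hs := hcov.fundamentalGroupToMulOpposite_surjective (x := π a)
    ⟨Quotient.mk _ (a, 1), rfl⟩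
  obtain ⟨w, hw⟩ := hpsi _ (h.psi a) (h.psi_fix a)
  have hall : ∀ γ : FundamentalGroup X (π a), γ = 1 ∨ γ = w := by
    intro γ
    obtain ⟨g, rfl⟩ := h.psi_surj a γ
    exact hw g
  set Φ := hcov.fundamentalGroupToMulOpposite (x := π a) ⟨Quotient.mk _ (a, 1), rfl⟩ with hΦ
  obtain ⟨γ0, hγ0⟩ := hs (MulOpposite.op (Multiplicative.ofAdd 1))
  have hne : γ0 ≠ 1 := by
    rintro rfl
    rw [map_one] at hγ0
    exact absurd hγ0 (by decide)
  have hw0 : γ0 = w := (hall γ0).resolve_left hne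
  have hinj : Function.Injective Φ := by
    rw [injective_iff_map_eq_one]
    intro γ hγ
    rcases hall γ with h1 | h1
    · exact h1
    · exfalso
      rw [h1, ← hw0, hγ0] at hγ
      exact absurd hγ (by decide)
  exact ⟨(MulEquiv.ofBijective Φ ⟨hinj, hs⟩).trans
    (MulOpposite.opMulEquiv (M := Multiplicative (ZMod 2))).symm⟩

end OrbPres

namespace X124

open Topology Complex

/-- The universal space. -/
abbrev EE : Type := ℝ × ℂ × ℂ × ℂ

/-- The deck transformation covering `F`. -/
noncomputable def ff : Equiv.Perm EE where
  toFun p := (p.1 + 1, I * p.2.1, I * p.2.2.1 - I * p.2.1, - p.2.2.2)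
  invFun p := (p.1 - 1, -I * p.2.1, -I * (p.2.2.1 + p.2.1), - p.2.2.2)
  left_inv := by
    rintro ⟨t, z1, z2, z3⟩
    simp only [Prod.mk.injEq]
    refine ⟨by ring, ?_, ?_, by ring⟩ <;> ring_nf <;> simp
  right_inv := by
    rintro ⟨t, z1, z2, z3⟩
    simp only [Prod.mk.injEq]
    refine ⟨by ring, ?_, ?_, by ring⟩ <;> ring_nf <;> simp

/-- The transformation covering `κ`. -/
noncomputable def kk : Equiv.Perm EE where
  toFun p := (1 - p.1, -(star p.2.1), star p.2.2.1 + star p.2.1, -(star p.2.2.2))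
  invFun p := (1 - p.1, -(star p.2.1), star p.2.2.1 + star p.2.1, -(star p.2.2.2))
  left_inv := by
    rintro ⟨t, z1, z2, z3⟩
    simp
  right_inv := by
    rintro ⟨t, z1, z2, z3⟩
    simp

/-- Gaussian integer as a complex number. -/
noncomputable def gi (l : ℤ × ℤ) : ℂ := (l.1 : ℂ) + (l.2 : ℂ) * I

/-- Translations. -/
noncomputable def tt (l m n : ℤ × ℤ) : Equiv.Perm EE where
  toFun p := (p.1, p.2.1 + gi l, p.2.2.1 + gi m, p.2.2.2 + gi n)
  invFun p := (p.1, p.2.1 - gi l, p.2.2.1 - gi m, p.2.2.2 - gi n)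
  left_inv := by rintro ⟨t, z1, z2, z3⟩; simp
  right_inv := by rintro ⟨t, z1, z2, z3⟩; simp

/-- The parity. -/
def par (l : ℤ × ℤ) : Multiplicative (ZMod 2) := Multiplicative.ofAdd ((l.1 + l.2 : ℤ) : ZMod 2)

/-- Generators. -/
def gens : Set (Equiv.Perm EE × Multiplicative (ZMod 2)) :=
  {(ff, 1), (kk, 1)} ∪ {x | ∃ l m n, x = (tt l m n, par l)}

/-- The group. -/
def GG : Subgroup (Equiv.Perm EE × Multiplicative (ZMod 2)) := Subgroup.closure gens

/-- Orientation preserving form. -/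
noncomputable def formP (n : ℤ) (l m k : ℤ × ℤ) (p : EE) : EE :=
  (p.1 + n, I ^ n * p.2.1 + gi l, I ^ n * (p.2.2.1 - n * p.2.1) + gi m,
    (-1) ^ n * p.2.2.2 + gi k)

/-- Reflecting form. -/
noncomputable def formM (n : ℤ) (l m k : ℤ × ℤ) (p : EE) : EE :=
  (n + 1 - p.1, -(I ^ n * star p.2.1) + gi l,
    I ^ n * (star p.2.2.1 + (n + 1) * star p.2.1) + gi m,
    -((-1) ^ n * star p.2.2.2) + gi k)

/-- Explicit form of the elements. -/
def Form (g : Equiv.Perm EE × Multiplicative (ZMod 2)) : Prop :=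
  ∃ (n : ℤ) (l m k : ℤ × ℤ), g.2 = par l ∧
    ((∀ p, g.1 p = formP n l m k p) ∨ (∀ p, g.1 p = formM n l m k p))

theorem gi_add (l m : ℤ × ℤ) : gi l + gi m = gi (l + m) := by
  simp [gi]; ring

theorem gi_neg (l : ℤ × ℤ) : - gi l = gi (-l) := by
  simp [gi]; ring

theorem gi_sub (l m : ℤ × ℤ) : gi l - gi m = gi (l - m) := by
  simp [gi]; ring

theorem gi_I (l : ℤ × ℤ) : I * gi l = gi (-l.2, l.1) := by
  simp only [gi]; push_cast; linear_combination (l.2 : ℂ) * I_mul_I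

theorem gi_star (l : ℤ × ℤ) : star (gi l) = gi (l.1, -l.2) := by
  simp [gi]

theorem gi_zero : gi 0 = 0 := by simp [gi]

theorem par_add (l m : ℤ × ℤ) : par (l + m) = par l * par m := by
  simp only [par, Prod.fst_add, Prod.snd_add, ← ofAdd_add]
  congr 1; push_cast; ring

theorem par_eq {l m : ℤ × ℤ} (h : ∃ c, l.1 + l.2 - (m.1 + m.2) = 2 * c) : par l = par m := by
  obtain ⟨c, hc⟩ := h
  simp only [par]
  congr 1
  have : (l.1 + l.2 : ℤ) = m.1 + m.2 + 2 * c := by omega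
  rw [this]; push_cast
  have h2 : (2 : ZMod 2) = 0 := rfl
  rw [h2]; ring

theorem par_two (c : ℤ × ℤ) (h : ∃ d, c.1 + c.2 = 2 * d) : par c = 1 := by
  obtain ⟨d, hd⟩ := h
  rw [par_eq (m := 0) ⟨d, by simpa using hd⟩]
  rfl

theorem star_Iz (n : ℤ) : star ((I : ℂ) ^ n) = I ^ (-n) := by
  change (starRingEnd ℂ) _ = _
  rw [map_zpow₀, conj_I, ← inv_I, inv_zpow']

theorem star_mz (n : ℤ) : star ((-1 : ℂ) ^ n) = (-1) ^ (-n) := by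
  change (starRingEnd ℂ) _ = _
  rw [map_zpow₀, map_neg, map_one, zpow_neg, ← inv_zpow]
  norm_num

theorem form_ff {g} (h : Form g) : Form ((ff, 1) * g) := by
  obtain ⟨n, l, m, k, hp, h | h⟩ := h
  · refine ⟨n + 1, (-l.2, l.1), (-m.2, m.1) - (-l.2, l.1), -k, ?_, Or.inl fun p => ?_⟩
    · rw [Prod.snd_mul, one_mul, hp]; exact par_eq ⟨l.2, by simp; ring⟩
    · simp only [Prod.fst_mul, Equiv.Perm.mul_apply, h, ff, formP, Equiv.coe_fn_mk, ← gi_I,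
        ← gi_sub, ← gi_neg, Prod.mk.injEq, zpow_add_one₀ I_ne_zero,
        zpow_add_one₀ (neg_ne_zero.2 (one_ne_zero (α := ℂ)))]
      push_cast
      refine ⟨?_, ?_, ?_, ?_⟩ <;> ring
  · refine ⟨n + 1, (-l.2, l.1), (-m.2, m.1) - (-l.2, l.1), -k, ?_, Or.inr fun p => ?_⟩
    · rw [Prod.snd_mul, one_mul, hp]; exact par_eq ⟨l.2, by simp; ring⟩
    · simp only [Prod.fst_mul, Equiv.Perm.mul_apply, h, ff, formM, Equiv.coe_fn_mk, ← gi_I,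
        ← gi_sub, ← gi_neg, Prod.mk.injEq, zpow_add_one₀ I_ne_zero,
        zpow_add_one₀ (neg_ne_zero.2 (one_ne_zero (α := ℂ)))]
      push_cast
      refine ⟨?_, ?_, ?_, ?_⟩ <;> ring

theorem form_ff' {g} (h : Form g) : Form ((ff, 1)⁻¹ * g) := by
  have hI : ∀ n : ℤ, (I : ℂ) ^ (n - 1) = - I * I ^ n := fun n => by
    rw [zpow_sub_one₀ I_ne_zero, inv_I]; ring
  have hm : ∀ n : ℤ, (-1 : ℂ) ^ (n - 1) = - (-1) ^ n := fun n => by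
    rw [zpow_sub_one₀ (by norm_num)]; norm_num
  have e : ∀ p, ff⁻¹ p = (p.1 - 1, -I * p.2.1, -I * (p.2.2.1 + p.2.1), - p.2.2.2) := fun p => rfl
  obtain ⟨n, l, m, k, hp, h | h⟩ := h
  · refine ⟨n - 1, -(-l.2, l.1), -((-m.2, m.1) + (-l.2, l.1)), -k, ?_, Or.inl fun p => ?_⟩
    · rw [Prod.snd_mul, Prod.snd_inv, inv_one, one_mul, hp]; exact par_eq ⟨l.1, by simp; ring⟩
    · simp only [Prod.fst_mul, Prod.fst_inv, Equiv.Perm.mul_apply, h, e, formP, ← gi_add,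
        ← gi_neg, ← gi_I, Prod.mk.injEq, hI, hm]
      push_cast
      refine ⟨?_, ?_, ?_, ?_⟩ <;> ring
  · refine ⟨n - 1, -(-l.2, l.1), -((-m.2, m.1) + (-l.2, l.1)), -k, ?_, Or.inr fun p => ?_⟩
    · rw [Prod.snd_mul, Prod.snd_inv, inv_one, one_mul, hp]; exact par_eq ⟨l.1, by simp; ring⟩
    · simp only [Prod.fst_mul, Prod.fst_inv, Equiv.Perm.mul_apply, h, e, formM, ← gi_add,
        ← gi_neg, ← gi_I, Prod.mk.injEq, hI, hm]
      push_cast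
      refine ⟨?_, ?_, ?_, ?_⟩ <;> ring

theorem form_kk {g} (h : Form g) : Form ((kk, 1) * g) := by
  have e : ∀ p, kk p = (1 - p.1, -(star p.2.1), star p.2.2.1 + star p.2.1, -(star p.2.2.2)) :=
    fun p => rfl
  obtain ⟨n, l, m, k, hp, h | h⟩ := h
  · refine ⟨-n, -(l.1, -l.2), (m.1, -m.2) + (l.1, -l.2), -(k.1, -k.2), ?_, Or.inr fun p => ?_⟩
    · rw [Prod.snd_mul, one_mul, hp]; exact par_eq ⟨l.1, by simp; ring⟩
    · simp only [Prod.fst_mul, Equiv.Perm.mul_apply, h, e, formM, formP, ← gi_add,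
        ← gi_neg, ← gi_star, Prod.mk.injEq, star_add, star_mul', star_Iz, star_mz, star_sub,
        star_intCast]
      push_cast
      refine ⟨?_, ?_, ?_, ?_⟩ <;> ring
  · refine ⟨-n, -(l.1, -l.2), (m.1, -m.2) + (l.1, -l.2), -(k.1, -k.2), ?_, Or.inl fun p => ?_⟩
    · rw [Prod.snd_mul, one_mul, hp]; exact par_eq ⟨l.1, by simp; ring⟩
    · simp only [Prod.fst_mul, Equiv.Perm.mul_apply, h, e, formM, formP, ← gi_add,
        ← gi_neg, ← gi_star, Prod.mk.injEq, star_add, star_mul', star_Iz, star_mz, star_neg,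
        star_intCast, star_star, star_one]
      push_cast
      refine ⟨?_, ?_, ?_, ?_⟩ <;> ring

theorem form_tt {g} (h : Form g) (a b c : ℤ × ℤ) : Form ((tt a b c, par a) * g) := by
  obtain ⟨n, l, m, k, hp, h | h⟩ := h
  · refine ⟨n, l + a, m + b, k + c, ?_, Or.inl fun p => ?_⟩
    · rw [Prod.snd_mul, hp, par_add, mul_comm]
    · simp only [Prod.fst_mul, Equiv.Perm.mul_apply, h, tt, formP, Equiv.coe_fn_mk, ← gi_add,
        add_assoc]
  · refine ⟨n, l + a, m + b, k + c, ?_, Or.inr fun p => ?_⟩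
    · rw [Prod.snd_mul, hp, par_add, mul_comm]
    · simp only [Prod.fst_mul, Equiv.Perm.mul_apply, h, tt, formM, Equiv.coe_fn_mk, ← gi_add,
        add_assoc]

theorem kk_inv : (kk, (1 : Multiplicative (ZMod 2)))⁻¹ = (kk, 1) := rfl

theorem tt_inv (l m n : ℤ × ℤ) :
    (tt l m n, par l)⁻¹ = (tt (-l) (-m) (-n), par (-l)) := by
  refine Prod.ext ?_ ?_
  · refine Equiv.ext fun p => ?_
    change (_, _, _, _) = (_, _, _, _)
    simp only [← gi_neg, sub_eq_add_neg]
  · change (par l)⁻¹ = _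
    rw [inv_eq_iff_mul_eq_one, ← par_add, add_neg_cancel]
    rfl

theorem form_one : Form 1 := by
  refine ⟨0, 0, 0, 0, rfl, Or.inl fun p => ?_⟩
  simp [formP, gi_zero]

theorem form_mem {g} (hg : g ∈ GG) : Form g := by
  unfold GG at hg
  induction hg using Subgroup.closure_induction_left with
  | one => exact form_one
  | mul_left x hx y hy ih =>
    rcases hx with (rfl | rfl) | ⟨l, m, n, rfl⟩
    · exact form_ff ih
    · exact form_kk ih
    · exact form_tt ih _ _ _
  | inv_mul_cancel x hx y hy ih =>
    rcases hx with (rfl | rfl) | ⟨l, m, n, rfl⟩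
    · exact form_ff' ih
    · rw [kk_inv]; exact form_kk ih
    · rw [tt_inv]; exact form_tt ih _ _ _

end X124

namespace X124

open Topology Complex Filter

noncomputable instance : MulAction GG EE where
  smul g p := g.1.1 p
  one_smul _ := rfl
  mul_smul _ _ _ := rfl

theorem smul_def' (g : GG) (p : EE) : g • p = g.1.1 p := rfl

theorem GG_cont (g : GG) : Continuous (fun e : EE => g • e) := by
  obtain ⟨n, l, m, k, -, h | h⟩ := form_mem g.2
  · simp only [smul_def', h, formP]; fun_prop
  · simp only [smul_def', h, formM]; fun_prop

theorem GG_aff (g : GG) (a b : EE) (s : ℝ) :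
    g • (AffineMap.lineMap a b s : EE) = AffineMap.lineMap (g • a) (g • b) s := by
  obtain ⟨n, l, m, k, -, h | h⟩ := form_mem g.2
  · simp only [smul_def', h, formP, AffineMap.lineMap_apply, vsub_eq_sub, vadd_eq_add,
      Prod.fst_add, Prod.snd_add, Prod.smul_fst, Prod.smul_snd, Prod.fst_sub, Prod.snd_sub,
      real_smul, smul_eq_mul]
    refine Prod.ext ?_ (Prod.ext ?_ (Prod.ext ?_ ?_)) <;> simp <;> ring
  · simp only [smul_def', h, formM, AffineMap.lineMap_apply, vsub_eq_sub, vadd_eq_add,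
      Prod.fst_add, Prod.snd_add, Prod.smul_fst, Prod.smul_snd, Prod.fst_sub, Prod.snd_sub,
      real_smul, smul_eq_mul]
    refine Prod.ext ?_ (Prod.ext ?_ (Prod.ext ?_ ?_)) <;> simp <;> ring

theorem ev_int (x : ℝ) : ∀ᶠ y in 𝓝 x, ∀ n : ℤ, (n : ℝ) = y → (n : ℝ) = x := by
  have hc : IsClosed (Set.range ((↑) : ℤ → ℝ) \ {x}) := by
    have : Set.range ((↑) : ℤ → ℝ) \ {x} = ((↑) : ℤ → ℝ) '' {n | (n : ℝ) ≠ x} := by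
      ext y; constructor
      · rintro ⟨⟨n, rfl⟩, h⟩; exact ⟨n, h, rfl⟩
      · rintro ⟨n, h, rfl⟩; exact ⟨⟨n, rfl⟩, h⟩
    rw [this]
    exact Int.isClosedEmbedding_coe_real.isClosedMap _ (isClosed_discrete _)
  filter_upwards [hc.isOpen_compl.mem_nhds (x := x) (by simp)] with y hy n hn
  by_contra hne
  exact hy ⟨⟨n, hn⟩, fun h => hne (hn.trans h)⟩

theorem ev_gi (x : ℂ) : ∀ᶠ y in 𝓝 x, ∀ l : ℤ × ℤ, gi l = y → gi l = x := by
  have h1 := (continuous_re.tendsto x).eventually (ev_int x.re)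
  have h2 := (continuous_im.tendsto x).eventually (ev_int x.im)
  filter_upwards [h1, h2] with y h1 h2 l hl
  have e1 : (gi l).re = l.1 := by simp [gi]
  have e2 : (gi l).im = l.2 := by simp [gi]
  apply Complex.ext
  · rw [e1]; exact h1 _ (by rw [← e1, hl])
  · rw [e2]; exact h2 _ (by rw [← e2, hl])

/-- Pull back an eventual statement along a continuous function on pairs. -/
theorem ev_pair {Y : Type*} [TopologicalSpace Y] (p : EE) (f : EE × EE → Y) (hf : Continuous f)
    {P : Y → Prop} (h : ∀ᶠ y in 𝓝 (f (p, p)), P y) : ∀ᶠ x in 𝓝 (p, p), P (f x) :=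
  (hf.tendsto (p, p)).eventually h

theorem GG_ev (p : EE) : ∀ᶠ x : EE × EE in 𝓝 (p, p), ∀ g : GG, g • x.1 = x.2 → g • p = p := by
  have hP : ∀ᶠ x : EE × EE in 𝓝 (p, p), ∀ n l m k, formP n l m k x.1 = x.2 →
      formP n l m k p = p := by
    have h0 := ev_pair p (fun x => x.2.1 - x.1.1) (by fun_prop) (ev_int _)
    have h1 := ev_pair p (fun x => x.2.2.1 - x.1.2.1) (by fun_prop) (ev_gi _)
    have h2 := ev_pair p (fun x => x.2.2.2.1 - x.1.2.2.1) (by fun_prop) (ev_gi _)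
    have h3 := ev_pair p (fun x => x.2.2.2.2 - x.1.2.2.2) (by fun_prop) (ev_gi _)
    filter_upwards [h0, h1, h2, h3] with x h0 h1 h2 h3 n l m k hx
    have hn : (n : ℝ) = 0 := by simpa using h0 n (by rw [← hx]; simp [formP])
    have hn' : n = 0 := by exact_mod_cast hn
    subst hn'
    have e1 := h1 l (by rw [← hx]; simp [formP])
    have e2 := h2 m (by rw [← hx]; simp [formP])
    have e3 := h3 k (by rw [← hx]; simp [formP])
    simp [formP, e1, e2, e3]
  have hM : ∀ᶠ x : EE × EE in 𝓝 (p, p), ∀ n l m k, formM n l m k x.1 = x.2 →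
      formM n l m k p = p := by
    have h0 := ev_pair p (fun x => x.2.1 + x.1.1 - 1) (by fun_prop) (ev_int _)
    by_cases hN : ∃ N : ℤ, (N : ℝ) = p.1 + p.1 - 1
    · obtain ⟨N, hN⟩ := hN
      have h1 := ev_pair p (fun x => x.2.2.1 + I ^ N * star x.1.2.1) (by fun_prop) (ev_gi _)
      have h2 := ev_pair p (fun x => x.2.2.2.1 -
        I ^ N * (star x.1.2.2.1 + (N + 1) * star x.1.2.1)) (by fun_prop) (ev_gi _)
      have h3 := ev_pair p (fun x => x.2.2.2.2 + (-1) ^ N * star x.1.2.2.2)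
        (by fun_prop) (ev_gi _)
      filter_upwards [h0, h1, h2, h3] with x h0 h1 h2 h3 n l m k hx
      have hn := h0 n (by rw [← hx]; simp only [formM]; ring)
      have hn' : n = N := by
        rw [← hN] at hn; exact_mod_cast hn
      subst hn'
      have e1 := h1 l (by rw [← hx]; simp only [formM]; ring)
      have e2 := h2 m (by rw [← hx]; simp only [formM]; ring)
      have e3 := h3 k (by rw [← hx]; simp only [formM]; ring)
      simp only [formM, e1, e2, e3, hn]
      refine Prod.ext ?_ (Prod.ext ?_ (Prod.ext ?_ ?_)) <;> simp
    · filter_upwards [h0] with x h0 n l m k hx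
      exact absurd ⟨n, h0 n (by rw [← hx]; simp only [formM]; ring)⟩ hN
  filter_upwards [hP, hM] with x hP hM g hg
  obtain ⟨n, l, m, k, -, h | h⟩ := form_mem g.2
  · rw [smul_def', h] at hg ⊢
    exact hP _ _ _ _ hg
  · rw [smul_def', h] at hg ⊢
    exact hM _ _ _ _ hg

theorem GG_loc (p : EE) : ∃ U : Set EE, IsOpen U ∧ Convex ℝ U ∧ p ∈ U ∧
    ∀ g : GG, ∀ u ∈ U, g • u ∈ U → g • p = p := by
  have h := GG_ev p
  rw [nhds_prod_eq] at h
  obtain ⟨W, hW, hW'⟩ := (eventually_prod_self_iff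
    (r := fun u v : EE => ∀ g : GG, g • u = v → g • p = p)).1 h
  obtain ⟨r, hr, hrW⟩ := Metric.mem_nhds_iff.1 hW
  exact ⟨Metric.ball p r, Metric.isOpen_ball, convex_ball p r, Metric.mem_ball_self hr,
    fun g u hu hgu => hW' u (hrW hu) _ (hrW hgu) g rfl⟩

/-- The parity homomorphism. -/
def phi : GG →* Multiplicative (ZMod 2) := (MonoidHom.snd _ _).comp GG.subtype

theorem I_zpow_cases (n : ℤ) : (Even n ∧ ((I : ℂ) ^ n = 1 ∨ (I : ℂ) ^ n = -1)) ∨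
    ((I : ℂ) ^ n = I ∨ (I : ℂ) ^ n = -I) := by
  have h2 : ∀ c : ℤ, (I : ℂ) ^ (2 * c) = (-1) ^ c := fun c => by
    have e : (I : ℂ) ^ (2 : ℤ) = -1 := by rw [zpow_ofNat]; exact I_sq
    rw [zpow_mul, e]
  rcases Int.even_or_odd' n with ⟨c, rfl | rfl⟩
  · left
    refine ⟨even_two_mul c, ?_⟩
    rw [h2]
    rcases Int.even_or_odd c with h | h
    · left; exact h.neg_one_zpow
    · right; exact h.neg_one_zpow
  · right
    rw [zpow_add_one₀ I_ne_zero, h2]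
    rcases Int.even_or_odd c with h | h
    · left; rw [h.neg_one_zpow]; ring
    · right; rw [h.neg_one_zpow]; ring

theorem half_int {n a b : ℤ} {x : ℝ} (hn : Even n) (h1 : 2 * x = a) (h2 : (n + 1) * x = b) :
    ∃ c : ℤ, a = 2 * c := by
  obtain ⟨k, rfl⟩ := hn
  refine ⟨b - k * a, ?_⟩
  have : (a : ℝ) = 2 * (b - k * a) := by
    rw [← h1, ← h2]; push_cast; ring
  exact_mod_cast this

theorem GG_fix (g : GG) (p : EE) (hp : g • p = p) : phi g = 1 := by
  obtain ⟨n, l, m, k, hpar, h | h⟩ := form_mem g.2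
  · change g.1.2 = 1
    rw [hpar]
    rw [smul_def', h] at hp
    have h0 := congrArg Prod.fst hp
    simp only [formP, add_eq_left, Int.cast_eq_zero] at h0
    subst h0
    have h1 := congrArg (fun q : EE => q.2.1) hp
    simp only [formP, zpow_zero, one_mul, add_eq_left] at h1
    have e1 := congrArg Complex.re h1
    have e2 := congrArg Complex.im h1
    simp [gi] at e1 e2
    exact par_two _ ⟨0, by simp [e1, e2]⟩
  · change g.1.2 = 1
    rw [hpar]
    rw [smul_def', h] at hp
    have h1 := congrArg (fun q : EE => q.2.1) hp
    have h2 := congrArg (fun q : EE => q.2.2.1) hp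
    simp only [formM] at h1 h2
    have e1 := congrArg Complex.re h1
    have e2 := congrArg Complex.im h1
    have e3 := congrArg Complex.re h2
    have e4 := congrArg Complex.im h2
    rcases I_zpow_cases n with ⟨hn, hI | hI⟩ | hI | hI
    · rw [hI] at e1 e2 e3 e4
      simp [gi] at e1 e2 e3 e4
      obtain ⟨c, hc⟩ := half_int (a := l.1) (b := -m.1) (x := p.2.1.re) hn (by linarith)
        (by push_cast; linarith)
      exact par_two _ ⟨c, by rw [e2, hc]; ring⟩
    · rw [hI] at e1 e2 e3 e4
      simp [gi] at e1 e2 e3 e4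
      obtain ⟨c, hc⟩ := half_int (a := l.2) (b := -m.2) (x := p.2.1.im) hn (by linarith)
        (by push_cast; linarith)
      exact par_two _ ⟨c, by rw [e1, hc]; ring⟩
    · rw [hI] at e1 e2
      simp [gi] at e1 e2
      have : l.1 = l.2 := by exact_mod_cast (by linarith : (l.1 : ℝ) = l.2)
      exact par_two _ ⟨l.2, by rw [this]; ring⟩
    · rw [hI] at e1 e2
      simp [gi] at e1 e2
      have : l.1 = -l.2 := by exact_mod_cast (by push_cast; linarith : (l.1 : ℝ) = (-l.2 : ℤ))
      exact par_two _ ⟨0, by rw [this]; ring⟩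

/-- Group elements. -/
noncomputable def Tm (l m n : ℤ × ℤ) : GG :=
  ⟨(tt l m n, par l), Subgroup.subset_closure (Or.inr ⟨l, m, n, rfl⟩)⟩

/-- The element `ff` of the group. -/
noncomputable def Fm : GG := ⟨(ff, 1), Subgroup.subset_closure (Or.inl (Or.inl rfl))⟩

/-- The element `kk` of the group. -/
noncomputable def Km : GG := ⟨(kk, 1), Subgroup.subset_closure (Or.inl (Or.inr rfl))⟩

theorem Tm_smul (l m n : ℤ × ℤ) (p : EE) :
    Tm l m n • p = (p.1, p.2.1 + gi l, p.2.2.1 + gi m, p.2.2.2 + gi n) := rfl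

theorem Fm_smul (p : EE) :
    Fm • p = (p.1 + 1, I * p.2.1, I * p.2.2.1 - I * p.2.1, - p.2.2.2) := rfl

theorem Km_smul (p : EE) :
    Km • p = (1 - p.1, -(star p.2.1), star p.2.2.1 + star p.2.1, -(star p.2.2.2)) := rfl

theorem conj_two' : (starRingEnd ℂ) 2 = 2 := map_ofNat _ 2

theorem phi_surj : Function.Surjective phi := by
  intro x
  obtain ⟨x, rfl⟩ := Multiplicative.ofAdd.surjective x
  refine ⟨Tm ((x.val : ℤ), 0) 0 0, ?_⟩
  change par ((x.val : ℤ), 0) = _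
  simp [par]

theorem Tm_add (l m n l' m' n' : ℤ × ℤ) :
    Tm (l + l') (m + m') (n + n') = Tm l m n * Tm l' m' n' := by
  refine Subtype.ext (Prod.ext (Equiv.ext fun p => ?_) (par_add _ _))
  change Tm _ _ _ • p = (Tm _ _ _ * Tm _ _ _) • p
  simp only [mul_smul, Tm_smul, ← gi_add]
  refine Prod.ext ?_ (Prod.ext ?_ (Prod.ext ?_ ?_)) <;> simp <;> ring

theorem Fm_Tm (l m n : ℤ × ℤ) :
    Fm * Tm l m n = Tm (-l.2, l.1) ((-m.2, m.1) - (-l.2, l.1)) (-n) * Fm := by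
  refine Subtype.ext (Prod.ext (Equiv.ext fun p => ?_) ?_)
  · change (Fm * Tm _ _ _) • p = (Tm _ _ _ * Fm) • p
    simp only [mul_smul, Tm_smul, Fm_smul, ← gi_add, ← gi_sub, ← gi_neg, ← gi_I]
    refine Prod.ext ?_ (Prod.ext ?_ (Prod.ext ?_ ?_)) <;> simp <;> ring
  · change 1 * par l = par _ * 1
    rw [one_mul, mul_one]
    exact par_eq ⟨l.2, by simp; ring⟩

section
variable {H : Type*} [Group H]

theorem psi_K (Ψ : GG →* H)
    (hΨ : ∀ (g : GG) (p : EE), g • p = p → Ψ g = 1) : Ψ Km = 1 := hΨ Km (1 / 2, 0, 0, 0) (by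
  change (_, _, _, _) = (_, _, _, _)
  simp; norm_num)

theorem psi_F (Ψ : GG →* H)
    (hΨ : ∀ (g : GG) (p : EE), g • p = p → Ψ g = 1) : Ψ Fm = 1 := by
  have : Ψ (Fm * Km) = 1 := hΨ _ (1, 0, 0, 0) (by
    rw [mul_smul, Fm_smul, Km_smul]
    simp)
  rwa [map_mul, psi_K Ψ hΨ, mul_one] at this

theorem psi_TK (Ψ : GG →* H)
    (hΨ : ∀ (g : GG) (p : EE), g • p = p → Ψ g = 1) (l m n : ℤ × ℤ) (p : EE) (h : (Tm l m n * Km) • p = p) : Ψ (Tm l m n) = 1 := by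
  have := hΨ _ p h
  rwa [map_mul, psi_K Ψ hΨ, mul_one] at this

theorem psi_TFK (Ψ : GG →* H)
    (hΨ : ∀ (g : GG) (p : EE), g • p = p → Ψ g = 1) (l m n : ℤ × ℤ) (p : EE) (h : (Tm l m n * (Fm * Km)) • p = p) :
    Ψ (Tm l m n) = 1 := by
  have := hΨ _ p h
  rwa [map_mul, map_mul, psi_K Ψ hΨ, psi_F Ψ hΨ, mul_one, mul_one] at this

theorem psi_rot (Ψ : GG →* H)
    (hΨ : ∀ (g : GG) (p : EE), g • p = p → Ψ g = 1) (l m n : ℤ × ℤ) :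
    Ψ (Tm l m n) = Ψ (Tm (-l.2, l.1) ((-m.2, m.1) - (-l.2, l.1)) (-n)) := by
  have := congrArg Ψ (Fm_Tm l m n)
  rwa [map_mul, map_mul, psi_F Ψ hΨ, one_mul, mul_one] at this

theorem psi_23a (Ψ : GG →* H)
    (hΨ : ∀ (g : GG) (p : EE), g • p = p → Ψ g = 1) (b a : ℤ) : Ψ (Tm 0 (0, b) (a, 0)) = 1 :=
  psi_TK Ψ hΨ _ _ _ (1 / 2, 0, (b / 2 : ℝ) * I, ((a / 2 : ℝ) : ℂ)) (by
    simp only [mul_smul, Tm_smul, Fm_smul, Km_smul, gi]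
    refine Prod.ext ?_ (Prod.ext ?_ (Prod.ext ?_ ?_)) <;> simp <;> ring)

theorem psi_3b (Ψ : GG →* H)
    (hΨ : ∀ (g : GG) (p : EE), g • p = p → Ψ g = 1) (b : ℤ) : Ψ (Tm 0 0 (0, b)) = 1 :=
  psi_TFK Ψ hΨ _ _ _ (1, 0, 0, (b / 2 : ℝ) * I) (by
    simp only [mul_smul, Tm_smul, Fm_smul, Km_smul, gi]
    refine Prod.ext ?_ (Prod.ext ?_ (Prod.ext ?_ ?_)) <;> simp [conj_two'] <;> ring)

theorem psi_2a (Ψ : GG →* H)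
    (hΨ : ∀ (g : GG) (p : EE), g • p = p → Ψ g = 1) (a : ℤ) : Ψ (Tm 0 (a, 0) 0) = 1 := by
  have h1 := psi_rot Ψ hΨ 0 (0, -a) 0
  rw [show (0 : ℤ × ℤ) = (0, 0) from rfl] at h1
  have h2 := psi_23a Ψ hΨ (-a) 0
  simp only [show (0 : ℤ × ℤ) = (0, 0) from rfl] at h2 ⊢
  rw [h2] at h1
  simpa using h1.symm

theorem psi_23 (Ψ : GG →* H)
    (hΨ : ∀ (g : GG) (p : EE), g • p = p → Ψ g = 1) (m n : ℤ × ℤ) : Ψ (Tm 0 m n) = 1 := by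
  have h : Tm 0 m n = Tm 0 (0, m.2) (n.1, 0) * Tm 0 (m.1, 0) 0 * Tm 0 0 (0, n.2) := by
    rw [← Tm_add, ← Tm_add]; simp
  rw [h, map_mul, map_mul, psi_23a Ψ hΨ, psi_2a Ψ hΨ, psi_3b Ψ hΨ]; simp

theorem psi_T (Ψ : GG →* H)
    (hΨ : ∀ (g : GG) (p : EE), g • p = p → Ψ g = 1) (l m n : ℤ × ℤ) : Ψ (Tm l m n) = Ψ (Tm l 0 0) := by
  have h : Tm l m n = Tm l 0 0 * Tm 0 m n := by rw [← Tm_add]; simp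
  rw [h, map_mul, psi_23 Ψ hΨ, mul_one]

theorem psi_even (Ψ : GG →* H)
    (hΨ : ∀ (g : GG) (p : EE), g • p = p → Ψ g = 1) (c : ℤ) : Ψ (Tm (2 * c, 0) 0 0) = 1 := by
  rw [← psi_T Ψ hΨ _ (-c, 0) 0]
  exact psi_TK Ψ hΨ _ _ _ (1 / 2, c, 0, 0) (by
    simp only [mul_smul, Tm_smul, Fm_smul, Km_smul, gi]
    refine Prod.ext ?_ (Prod.ext ?_ (Prod.ext ?_ ?_)) <;> simp <;> ring)

theorem psi_real (Ψ : GG →* H)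
    (hΨ : ∀ (g : GG) (p : EE), g • p = p → Ψ g = 1) (l : ℤ × ℤ) : Ψ (Tm l 0 0) = Ψ (Tm (l.1 + l.2, 0) 0 0) := by
  have h : Tm l 0 0 = Tm (l.1, 0) 0 0 * Tm (0, l.2) 0 0 := by rw [← Tm_add]; simp
  have h' : Tm (l.1 + l.2, 0) 0 0 = Tm (l.1, 0) 0 0 * Tm (l.2, 0) 0 0 := by rw [← Tm_add]; simp
  have h2 := psi_rot Ψ hΨ (l.2, 0) 0 0
  rw [psi_T Ψ hΨ (-((l.2, 0) : ℤ × ℤ).2, ((l.2, 0) : ℤ × ℤ).1)] at h2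
  rw [h, h', map_mul, map_mul, h2]
  simp

theorem psi_T_mem (Ψ : GG →* H)
    (hΨ : ∀ (g : GG) (p : EE), g • p = p → Ψ g = 1) (l m n : ℤ × ℤ) : Ψ (Tm l m n) = 1 ∨ Ψ (Tm l m n) = Ψ (Tm (1, 0) 0 0) := by
  rw [psi_T Ψ hΨ, psi_real Ψ hΨ]
  rcases Int.even_or_odd' (l.1 + l.2) with ⟨c, hc | hc⟩
  · left; rw [hc, psi_even Ψ hΨ]
  · right
    have h : Tm (2 * c + 1, 0) 0 0 = Tm (2 * c, 0) 0 0 * Tm (1, 0) 0 0 := by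
      rw [← Tm_add]; simp
    rw [hc, h, map_mul, psi_even Ψ hΨ, one_mul]

theorem psi_all (Ψ : GG →* H)
    (hΨ : ∀ (g : GG) (p : EE), g • p = p → Ψ g = 1) (g : GG) : Ψ g = 1 ∨ Ψ g = Ψ (Tm (1, 0) 0 0) := by
  have hw : Ψ (Tm (1, 0) 0 0) * Ψ (Tm (1, 0) 0 0) = 1 := by
    have := psi_even Ψ hΨ 1
    rw [← map_mul, ← Tm_add]
    simpa using this
  obtain ⟨g, hg⟩ := g
  have hg' : g ∈ Subgroup.closure gens := hg
  induction hg' using Subgroup.closure_induction with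
  | mem x hx =>
    rcases hx with (rfl | rfl) | ⟨l, m, n, rfl⟩
    · exact Or.inl (psi_F Ψ hΨ)
    · exact Or.inl (psi_K Ψ hΨ)
    · exact psi_T_mem Ψ hΨ l m n
  | one => exact Or.inl (map_one Ψ)
  | mul x y hx hy ihx ihy =>
    have e : Ψ ⟨x * y, hg⟩ = Ψ ⟨x, hx⟩ * Ψ ⟨y, hy⟩ := by rw [← map_mul]; rfl
    rw [e]
    rcases ihx hx with h1 | h1 <;> rcases ihy hy with h2 | h2 <;> rw [h1, h2] <;> simp [hw]
  | inv x hx ih =>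
    have e : Ψ ⟨x⁻¹, hg⟩ = (Ψ ⟨x, hx⟩)⁻¹ := by rw [← map_inv]; rfl
    rw [e]
    rcases ih hx with h1 | h1
    · left; rw [h1, inv_one]
    · right; rw [h1, inv_eq_iff_mul_eq_one, hw]

end

end X124

namespace X124

open Topology Complex

theorem gi_mem (l : ℤ × ℤ) : gi l ∈ Γ₂ := by
  have h1 : (1 : ℂ) ∈ Γ₂ := AddSubgroup.subset_closure (Or.inl rfl)
  have h2 : I ∈ Γ₂ := AddSubgroup.subset_closure (Or.inr rfl)
  have h := add_mem (zsmul_mem h1 l.1) (zsmul_mem h2 l.2)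
  simpa [gi] using h

theorem mem_gi {x : ℂ} (hx : x ∈ Γ₂) : ∃ l, x = gi l := by
  unfold Γ₂ at hx
  induction hx using AddSubgroup.closure_induction with
  | mem x hx =>
    rcases hx with rfl | rfl
    · exact ⟨(1, 0), by simp [gi]⟩
    · exact ⟨(0, 1), by simp [gi]⟩
  | zero => exact ⟨0, gi_zero.symm⟩
  | add x y _ _ hx hy =>
    obtain ⟨l, rfl⟩ := hx
    obtain ⟨m, rfl⟩ := hy
    exact ⟨_, gi_add l m⟩
  | neg x _ hx =>
    obtain ⟨l, rfl⟩ := hx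
    exact ⟨_, gi_neg l⟩

theorem mk_add_gi (z : ℂ) (l : ℤ × ℤ) : mk₂ (z + gi l) = mk₂ z :=
  QuotientAddGroup.mk_add_of_mem _ (gi_mem l)

theorem mk_eq {z w : ℂ} (h : mk₂ z = mk₂ w) : ∃ l, w = z + gi l := by
  obtain ⟨l, hl⟩ := mem_gi (QuotientAddGroup.eq.1 h)
  exact ⟨l, by rw [← hl]; ring⟩

/-- The projection onto `ℝ × T₂`. -/
noncomputable def qq : EE → ℝ × T₂ := Prod.map id (Prod.map mk₂ (Prod.map mk₂ mk₂))

theorem qq_quot : IsQuotientMap qq := by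
  have h : IsOpenQuotientMap mk₂ := QuotientAddGroup.isOpenQuotientMap_mk
  exact (IsOpenQuotientMap.id.prodMap (h.prodMap (h.prodMap h))).isQuotientMap

theorem qq_Tm (l m n : ℤ × ℤ) (p : EE) : qq (Tm l m n • p) = qq p := by
  rw [Tm_smul]
  simp only [qq, Prod.map, mk_add_gi]

theorem qq_eq {a b : EE} (h : qq a = qq b) : ∃ l m n, Tm l m n • a = b := by
  obtain ⟨t, z1, z2, z3⟩ := a
  obtain ⟨s, w1, w2, w3⟩ := b
  simp only [qq, Prod.map, Prod.mk.injEq, id] at h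
  obtain ⟨h0, h1, h2, h3⟩ := h
  obtain ⟨l, rfl⟩ := mk_eq h1
  obtain ⟨m, rfl⟩ := mk_eq h2
  obtain ⟨n, rfl⟩ := mk_eq h3
  exact ⟨l, m, n, by rw [Tm_smul, h0]⟩

section
variable (F : T₂ → T₂)

/-- The projection onto `X`. -/
noncomputable def proj
    (κ : Quot (mtRel F) → Quot (mtRel F)) (p : EE) : Quot (fun a b => b = κ a) := Quot.mk _ (Quot.mk _ (qq p))

theorem proj_quot
    (κ : Quot (mtRel F) → Quot (mtRel F)) : IsQuotientMap (proj F κ) :=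
  isQuotientMap_quot_mk.comp (isQuotientMap_quot_mk.comp qq_quot)

theorem F_rel
    (hF : ∀ z₁ z₂ z₃ : ℂ,
      F (mk₂ z₁, mk₂ z₂, mk₂ z₃) =
        (mk₂ (Complex.I * z₁), mk₂ (Complex.I * z₂ - Complex.I * z₁), mk₂ (-z₃))) (p : EE) : mtRel F (qq p) (qq (Fm • p)) := by
  rw [Fm_smul]
  simp only [mtRel, qq, Prod.map, hF, id]

theorem K_rel
    (κ : Quot (mtRel F) → Quot (mtRel F))
    (hκ : ∀ (t : ℝ) (z₁ z₂ z₃ : ℂ),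
      κ (Quot.mk (mtRel F) (t, (mk₂ z₁, mk₂ z₂, mk₂ z₃))) =
        Quot.mk (mtRel F)
          (1 - t, (mk₂ (-(star z₁)), mk₂ (star z₂ + star z₁), mk₂ (-(star z₃))))) (p : EE) : Quot.mk (mtRel F) (qq (Km • p)) = κ (Quot.mk (mtRel F) (qq p)) := by
  rw [Km_smul]
  simp only [qq, Prod.map, hκ, id]

theorem proj_smul
    (hF : ∀ z₁ z₂ z₃ : ℂ,
      F (mk₂ z₁, mk₂ z₂, mk₂ z₃) =
        (mk₂ (Complex.I * z₁), mk₂ (Complex.I * z₂ - Complex.I * z₁), mk₂ (-z₃)))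
    (κ : Quot (mtRel F) → Quot (mtRel F))
    (hκ : ∀ (t : ℝ) (z₁ z₂ z₃ : ℂ),
      κ (Quot.mk (mtRel F) (t, (mk₂ z₁, mk₂ z₂, mk₂ z₃))) =
        Quot.mk (mtRel F)
          (1 - t, (mk₂ (-(star z₁)), mk₂ (star z₂ + star z₁), mk₂ (-(star z₃))))) (g : GG) (p : EE) : proj F κ (g • p) = proj F κ p := by
  obtain ⟨g, hg⟩ := g
  have hg' : g ∈ Subgroup.closure gens := hg
  induction hg' using Subgroup.closure_induction generalizing p with
  | mem x hx =>
    rcases hx with (rfl | rfl) | ⟨l, m, n, rfl⟩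
    · exact congrArg (Quot.mk (fun a b => b = κ a)) (Quot.sound (F_rel F hF p)).symm
    · exact (Quot.sound (r := fun a b => b = κ a) (K_rel F κ hκ p)).symm
    · exact congrArg (fun y => Quot.mk _ (Quot.mk _ y)) (qq_Tm l m n p)
  | one => rfl
  | mul x y hx hy ihx ihy => exact (ihx (y.1 p) hx).trans (ihy p hy)
  | inv x hx ih =>
    have h := ih (x.1⁻¹ p) hx
    have e : (⟨x, hx⟩ : GG) • (x.1⁻¹ p) = p := x.1.apply_symm_apply p
    rw [e] at h
    exact h.symm

/-- Orbit membership on `ℝ × T₂`. -/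
def orbS (a : EE) (y : ℝ × T₂) : Prop := ∃ g : GG, qq (g • a) = y

theorem orbS_qq (a b : EE) : orbS a (qq b) ↔ ∃ g : GG, g • a = b := by
  constructor
  · rintro ⟨g, hg⟩
    obtain ⟨l, m, n, h⟩ := qq_eq hg
    exact ⟨Tm l m n * g, by rw [mul_smul, h]⟩
  · rintro ⟨g, rfl⟩
    exact ⟨g, rfl⟩

theorem orbS_smul (a b : EE) (g : GG) : orbS a (qq b) = orbS a (qq (g • b)) := by
  rw [orbS_qq, orbS_qq]
  refine propext ⟨?_, ?_⟩
  · rintro ⟨k, rfl⟩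
    exact ⟨g * k, mul_smul _ _ _⟩
  · rintro ⟨k, hk⟩
    exact ⟨g⁻¹ * k, by rw [mul_smul, hk, inv_smul_smul]⟩

theorem proj_orb
    (hF : ∀ z₁ z₂ z₃ : ℂ,
      F (mk₂ z₁, mk₂ z₂, mk₂ z₃) =
        (mk₂ (Complex.I * z₁), mk₂ (Complex.I * z₂ - Complex.I * z₁), mk₂ (-z₃)))
    (κ : Quot (mtRel F) → Quot (mtRel F))
    (hκ : ∀ (t : ℝ) (z₁ z₂ z₃ : ℂ),
      κ (Quot.mk (mtRel F) (t, (mk₂ z₁, mk₂ z₂, mk₂ z₃))) =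
        Quot.mk (mtRel F)
          (1 - t, (mk₂ (-(star z₁)), mk₂ (star z₂ + star z₁), mk₂ (-(star z₃))))) (a b : EE) : proj F κ a = proj F κ b ↔ ∃ g : GG, g • a = b := by
  constructor
  · intro h
    have h1 : ∀ x y, mtRel F x y → orbS a x = orbS a y := by
      intro x y hxy
      obtain ⟨p, rfl⟩ := qq_quot.surjective x
      have e : y = qq (Fm • p) := hxy.trans (F_rel F hF p).symm
      rw [e]
      exact orbS_smul a p Fm
    have h2 : ∀ x y : Quot (mtRel F), y = κ x →
        Quot.lift (orbS a) h1 x = Quot.lift (orbS a) h1 y := by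
      intro x y hxy
      obtain ⟨p, rfl⟩ := (isQuotientMap_quot_mk.comp qq_quot).surjective x
      have e : y = Quot.mk (mtRel F) (qq (Km • p)) := hxy.trans (K_rel F κ hκ p).symm
      rw [e]
      exact orbS_smul a p Km
    have h3 := congrArg (Quot.lift (Quot.lift (orbS a) h1) h2) h
    have h4 : orbS a (qq a) = orbS a (qq b) := h3
    rw [← orbS_qq, ← h4]
    exact ⟨1, by rw [one_smul]⟩
  · rintro ⟨g, rfl⟩
    exact (proj_smul F hF κ hκ g a).symm

theorem orbPres
    (hF : ∀ z₁ z₂ z₃ : ℂ,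
      F (mk₂ z₁, mk₂ z₂, mk₂ z₃) =
        (mk₂ (Complex.I * z₁), mk₂ (Complex.I * z₂ - Complex.I * z₁), mk₂ (-z₃)))
    (κ : Quot (mtRel F) → Quot (mtRel F))
    (hκ : ∀ (t : ℝ) (z₁ z₂ z₃ : ℂ),
      κ (Quot.mk (mtRel F) (t, (mk₂ z₁, mk₂ z₂, mk₂ z₃))) =
        Quot.mk (mtRel F)
          (1 - t, (mk₂ (-(star z₁)), mk₂ (star z₂ + star z₁), mk₂ (-(star z₃))))) : OrbPres (G := GG) (proj F κ) where
  cont := GG_cont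
  aff := GG_aff
  quot := proj_quot F κ
  orb := proj_orb F hF κ hκ
  loc := GG_loc

end

end X124

/-- Let `F : T → T` be induced by `z ↦ (iz₁, iz₂ − iz₁, −z₃)`, `M` the mapping torus of
`F`, `κ[t,x] = [1−t, η x]` with `η` induced by `z ↦ (−z̄₁, z̄₂ + z̄₁, −z̄₃)`, and
`X = M/κ`. Then `X` is path-connected with fundamental group `ℤ/2ℤ`. -/
theorem fundamental_group_X124 (F : T₂ → T₂)
    (hF : ∀ z₁ z₂ z₃ : ℂ,
      F (mk₂ z₁, mk₂ z₂, mk₂ z₃) =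
        (mk₂ (Complex.I * z₁), mk₂ (Complex.I * z₂ - Complex.I * z₁), mk₂ (-z₃)))
    (κ : Quot (mtRel F) → Quot (mtRel F))
    (hκ : ∀ (t : ℝ) (z₁ z₂ z₃ : ℂ),
      κ (Quot.mk (mtRel F) (t, (mk₂ z₁, mk₂ z₂, mk₂ z₃))) =
        Quot.mk (mtRel F)
          (1 - t, (mk₂ (-(star z₁)), mk₂ (star z₂ + star z₁), mk₂ (-(star z₃))))) :
    PathConnectedSpace (Quot (fun a b => b = κ a)) ∧
      ∀ x : Quot (fun a b => b = κ a),
        Nonempty (FundamentalGroup (Quot (fun a b => b = κ a)) x ≃*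
          Multiplicative (ZMod 2)) := by
  exact (X124.orbPres F hF κ hκ).main X124.phi X124.phi_surj X124.GG_fix
    fun _ Ψ hΨ => ⟨_, X124.psi_all Ψ hΨ⟩
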